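/- Let n be a positive integer, Γ, γ ∈ ℝ, and α₁,…,α_n, β₁,…,β_n ∈ [0,1] satisfy the (P2) constraints: γ ≥ Γ; Σ_{i=1}^{n}(α_i+β_i) ≥ 2Γn; for every i ∈ {1,…,n}, (1−e^{α_i−1}) + (1−e^{β_i−1}) ≥ Γ; for every i ∈ {1,…,n}, Σ_{j=1}^{i−1} α_j + (n−i+1)·α_i ≤ Σ_{j=1}^{i} β_j + n·γ; and Σ_{i=1}^{n} α_i ≥ n·γ + Σ_{i=1}^{n} β_i. Suppose i < j are indices with (1−e^{α_i−1}) + (1−e^{β_i−1}) > Γ, β_i < 1, and β_j > 0. Then for all sufficiently small ε > 0, replacing β_i by β_i + ε and β_j by β_j − ε (keeping everything else unchanged) yields numbers that again satisfy all the (P2) constraints above. -/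

import Mathlib

open Finset Real

/-- The constraints of the optimization problem (P2) (including `α_i, β_i ∈ [0,1]`,
without the monotonicity requirements on `α` and `β`). -/
def P2Constraints (n : ℕ) (Γ γ : ℝ) (α β : ℕ → ℝ) : Prop :=
  (∀ i ∈ Finset.Icc 1 n, α i ∈ Set.Icc (0:ℝ) 1 ∧ β i ∈ Set.Icc (0:ℝ) 1) ∧
  Γ ≤ γ ∧
  2 * Γ * n ≤ ∑ i ∈ Finset.Icc 1 n, (α i + β i) ∧
  (∀ i ∈ Finset.Icc 1 n,
    Γ ≤ (1 - Real.exp (α i - 1)) + (1 - Real.exp (β i - 1))) ∧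
  (∀ i ∈ Finset.Icc 1 n,
    (∑ j ∈ Finset.Icc 1 (i - 1), α j) + ((n:ℝ) - i + 1) * α i
      ≤ (∑ j ∈ Finset.Icc 1 i, β j) + n * γ) ∧
  n * γ + ∑ i ∈ Finset.Icc 1 n, β i ≤ ∑ i ∈ Finset.Icc 1 n, α i

/-- Moving mass `ε` from index `j` to index `i` amounts to adding two indicator terms. -/
theorem update_update_transfer_apply (β : ℕ → ℝ) {i j : ℕ} (hij : i ≠ j) (ε : ℝ) (k : ℕ) :
    Function.update (Function.update β i (β i + ε)) j (β j - ε) k =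
      β k + (if k = i then ε else 0) - (if k = j then ε else 0) := by
  by_cases hkj : k = j
  · subst hkj
    simp [hij.symm]
  · by_cases hki : k = i
    · subst hki
      simp [hij]
    · simp [hkj, hki]

theorem sum_update_update_transfer (s : Finset ℕ) (β : ℕ → ℝ) {i j : ℕ} (hij : i ≠ j) (ε : ℝ) :
    ∑ k ∈ s, Function.update (Function.update β i (β i + ε)) j (β j - ε) k =
      ∑ k ∈ s, β k + (if i ∈ s then ε else 0) - (if j ∈ s then ε else 0) := by
  simp only [update_update_transfer_apply β hij, Finset.sum_sub_distrib, Finset.sum_add_distrib,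
    Finset.sum_ite_eq']

/-- **Exchange step for (P2).**
If `(Γ,γ,α,β)` is feasible for (P2), `i < j`, the per-index constraint at `i` is
strictly slack, `β_i < 1`, and `β_j > 0`, then for all sufficiently small `ε > 0`,
replacing `β_i` by `β_i + ε` and `β_j` by `β_j − ε` keeps all (P2) constraints. -/
theorem P2_exchange_feasible
    (n : ℕ) (hn : 0 < n) (Γ γ : ℝ) (α β : ℕ → ℝ)
    (hfeas : P2Constraints n Γ γ α β)
    (i j : ℕ) (hi : i ∈ Finset.Icc 1 n) (hj : j ∈ Finset.Icc 1 n) (hij : i < j)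
    (hslack : Γ < (1 - Real.exp (α i - 1)) + (1 - Real.exp (β i - 1)))
    (hβi : β i < 1) (hβj : 0 < β j) :
    ∃ ε₀ > 0, ∀ ε : ℝ, 0 < ε → ε ≤ ε₀ →
      P2Constraints n Γ γ α
        (Function.update (Function.update β i (β i + ε)) j (β j - ε)) := by
  obtain ⟨hbox, hγ, hsum, hexp, hprefix, htotal⟩ := hfeas
  have hcont : ContinuousAt
      (fun ε : ℝ => (1 - Real.exp (α i - 1)) + (1 - Real.exp (β i + ε - 1))) 0 := by
    fun_prop
  have hnear : ∀ᶠ ε in nhds (0 : ℝ),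
      Γ < (1 - Real.exp (α i - 1)) + (1 - Real.exp (β i + ε - 1)) :=
    hcont.eventually (lt_mem_nhds (by simpa using hslack))
  obtain ⟨δ, hδ, hball⟩ := Metric.eventually_nhds_iff.mp hnear
  refine ⟨min (δ / 2) (min (1 - β i) (β j)),
    lt_min (half_pos hδ) (lt_min (sub_pos.mpr hβi) hβj), fun ε hε hle => ?_⟩
  obtain ⟨hεδ, hεi, hεj⟩ : ε ≤ δ / 2 ∧ ε ≤ 1 - β i ∧ ε ≤ β j := by
    simpa only [le_min_iff] using hle
  have hβsum : ∑ k ∈ Finset.Icc 1 n,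
      Function.update (Function.update β i (β i + ε)) j (β j - ε) k =
        ∑ k ∈ Finset.Icc 1 n, β k := by
    rw [sum_update_update_transfer _ _ hij.ne, if_pos hi, if_pos hj]
    ring
  refine ⟨fun k hk => ⟨(hbox k hk).1, ?_⟩, hγ, ?_, fun k hk => ?_, fun k hk => ?_, ?_⟩
  · obtain ⟨h0, h1⟩ := (hbox k hk).2
    rw [update_update_transfer_apply β hij.ne]
    rw [Set.mem_Icc]
    split_ifs with hki hkj hkj
    · omega
    · subst hki
      constructor <;> linarith
    · subst hkj
      constructor <;> linarith
    · constructor <;> linarith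
  · rw [Finset.sum_add_distrib, hβsum, ← Finset.sum_add_distrib]
    exact hsum
  · by_cases hki : k = i
    · subst hki
      rw [Function.update_of_ne hij.ne, Function.update_self]
      refine (hball ?_).le
      rw [Real.dist_eq, sub_zero, abs_of_pos hε]
      linarith
    · refine (hexp k hk).trans ?_
      have hβk : Function.update (Function.update β i (β i + ε)) j (β j - ε) k ≤ β k := by
        rw [update_update_transfer_apply β hij.ne, if_neg hki]
        split_ifs <;> linarith
      gcongr
  · refine (hprefix k hk).trans ?_
    rw [sum_update_update_transfer _ _ hij.ne]
    have hmem : j ∈ Finset.Icc 1 k → i ∈ Finset.Icc 1 k := by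
      simp only [Finset.mem_Icc] at hi ⊢
      omega
    split_ifs with hik hjk hjk
    · linarith
    · linarith
    · exact absurd (hmem hjk) hik
    · linarith
  · rw [hβsum]
    exact htotal
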